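/- Let (X,d) be a compact metric space and μ, ν probability measures on X. Define W̃(μ,ν) as the infimum over all complex measures ρ on X×X with marginals μ and ν of ∬ d(x,y) d|ρ|(x,y). Then W̃(μ,ν) equals the Kantorovich–Wasserstein distance W(μ,ν), defined as the infimum of ∬ d(x,y) dρ(x,y) over probability measures ρ on X×X with marginals μ and ν. -/

import Mathlib

open MeasureTheory

open scoped CompactlySupported

/-- If every pair of continuous functions `φ, ψ` with `φ x + ψ y ≤ c + t * d(x, y)` satisfies
`∫ φ dμ + ∫ ψ dν ≤ c + t * r`, then some coupling of `μ` and `ν` has transport cost at most `r`. -/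
theorem exists_coupling_integral_dist_le {X : Type*} [MetricSpace X] [CompactSpace X]
    [MeasurableSpace X] [BorelSpace X] (μ ν : Measure X) [IsProbabilityMeasure μ]
    [IsProbabilityMeasure ν] (r : ℝ)
    (h : ∀ (φ ψ : C(X, ℝ)) (c t : ℝ), 0 ≤ t → (∀ x y, φ x + ψ y ≤ c + t * dist x y) →
      ∫ x, φ x ∂μ + ∫ y, ψ y ∂ν ≤ c + t * r) :
    ∃ ρ : Measure (X × X), IsProbabilityMeasure ρ ∧ ρ.fst = μ ∧ ρ.snd = ν ∧
      ∫ p, dist p.1 p.2 ∂ρ ≤ r := by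
  have : SecondCountableTopology X := UniformSpace.secondCountable_of_separable X
  have : Nonempty X := nonempty_of_isProbabilityMeasure μ
  have hfi (m : Measure X) [IsProbabilityMeasure m] (f : C(X, ℝ)) : Integrable f m :=
    f.continuous.integrable_of_hasCompactSupport (HasCompactSupport.of_compactSpace _)
  let s : PointedCone ℝ C(X × X, ℝ) :=
    { carrier := {k | ∃ (φ ψ : C(X, ℝ)) (t : ℝ), 0 ≤ t ∧ ∫ x, φ x ∂μ + ∫ y, ψ y ∂ν = 0 ∧
        ∀ x y, φ x + ψ y + t * (r - dist x y) ≤ k (x, y)}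
      zero_mem' := ⟨0, 0, 0, le_rfl, by simp, by simp⟩
      add_mem' := by
        rintro k₁ k₂ ⟨φ₁, ψ₁, t₁, ht₁, h₁, hk₁⟩ ⟨φ₂, ψ₂, t₂, ht₂, h₂, hk₂⟩
        refine ⟨φ₁ + φ₂, ψ₁ + ψ₂, t₁ + t₂, add_nonneg ht₁ ht₂, ?_, fun x y => ?_⟩
        · simp only [ContinuousMap.add_apply]
          rw [integral_add (hfi μ _) (hfi μ _), integral_add (hfi ν _) (hfi ν _)]
          linarith
        · simp only [ContinuousMap.add_apply]
          linarith [hk₁ x y, hk₂ x y]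
      smul_mem' := by
        rintro ⟨a, ha⟩ k ⟨φ, ψ, t, ht, h0, hk⟩
        refine ⟨a • φ, a • ψ, a * t, mul_nonneg ha ht, ?_, fun x y => ?_⟩
        · simp only [ContinuousMap.smul_apply, smul_eq_mul]
          rw [integral_const_mul, integral_const_mul, ← mul_add, h0, mul_zero]
        · have := mul_le_mul_of_nonneg_left (hk x y) ha
          simp only [ContinuousMap.smul_apply, smul_eq_mul, Nonneg.mk_smul]
          linarith }
  have mem_s (k : C(X × X, ℝ)) : k ∈ s ↔ ∃ (φ ψ : C(X, ℝ)) (t : ℝ), 0 ≤ t ∧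
      ∫ x, φ x ∂μ + ∫ y, ψ y ∂ν = 0 ∧
      ∀ x y, φ x + ψ y + t * (r - dist x y) ≤ k (x, y) := Iff.rfl
  have mem_of_nonneg (k : C(X × X, ℝ)) (hk : ∀ p, 0 ≤ k p) : k ∈ s :=
    (mem_s k).2 ⟨0, 0, 0, le_rfl, by simp, by simpa using hk⟩
  obtain ⟨L, hL1, hLs⟩ := riesz_extension s
    (LinearPMap.mkSpanSingleton (σ := RingHom.id ℝ) (1 : C(X × X, ℝ)) (1 : ℝ) one_ne_zero)
    (by
      rintro ⟨k, hk⟩ hks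
      obtain ⟨a, rfl⟩ := Submodule.mem_span_singleton.1 hk
      obtain ⟨φ, ψ, t, ht, h0, hk'⟩ := (mem_s _).1 hks
      have := h φ ψ (a - t * r) t ht fun x y => by
        have := hk' x y
        simp only [ContinuousMap.smul_apply, ContinuousMap.one_apply, smul_eq_mul] at this
        linarith
      have e := LinearPMap.mkSpanSingleton'_apply (σ := RingHom.id ℝ) (1 : C(X × X, ℝ)) (1 : ℝ)
        (fun c hc => by simpa using hc) a hk
      refine le_of_le_of_eq ?_ e.symm
      simp only [RingHom.id_apply, smul_eq_mul, mul_one]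
      linarith)
    (fun k => ⟨⟨‖k‖ • 1, Submodule.smul_mem _ _ (Submodule.mem_span_singleton_self _)⟩,
      mem_of_nonneg _ fun p => by
        have := (abs_le.1 (k.norm_coe_le_norm p)).1
        simp only [ContinuousMap.add_apply, ContinuousMap.smul_apply, ContinuousMap.one_apply,
          smul_eq_mul]
        linarith⟩)
  replace hL1 : L 1 = 1 := by
    rw [hL1 ⟨1, Submodule.mem_span_singleton_self _⟩]
    exact LinearPMap.mkSpanSingleton_apply ℝ ℝ (σ := RingHom.id ℝ) one_ne_zero (1 : ℝ)
  have hmarg (φ ψ : C(X, ℝ)) (h0 : ∫ x, φ x ∂μ + ∫ y, ψ y ∂ν = 0) (k : C(X × X, ℝ))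
      (hk : ∀ x y, k (x, y) = φ x + ψ y) : L k = 0 := by
    apply le_antisymm
    · have := hLs (-k) ((mem_s _).2 ⟨-φ, -ψ, 0, le_rfl, by
        simp only [ContinuousMap.neg_apply, integral_neg]; linarith, fun x y => by
        simp only [ContinuousMap.neg_apply, hk]; linarith⟩)
      rw [map_neg] at this
      linarith
    · exact hLs k ((mem_s _).2 ⟨φ, ψ, 0, le_rfl, h0, fun x y => by rw [hk]; linarith⟩)
  let Λ : C_c(X × X, ℝ) →ₚ[ℝ] ℝ := PositiveLinearMap.mk₀
    { toFun := fun f => L f.toContinuousMap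
      map_add' := fun f g => L.map_add f.toContinuousMap g.toContinuousMap
      map_smul' := fun a f => L.map_smul a f.toContinuousMap }
    (fun f hf => hLs _ (mem_of_nonneg _ hf))
  let ρ := RealRMK.rieszMeasure Λ
  have hρ (k : C(X × X, ℝ)) : ∫ p, k p ∂ρ = L k :=
    RealRMK.integral_rieszMeasure Λ (CompactlySupportedContinuousMap.continuousMapEquiv k)
  have : IsFiniteMeasure ρ := by
    have : IsFiniteMeasureOnCompacts ρ := by unfold ρ RealRMK.rieszMeasure; infer_instance
    exact CompactSpace.isFiniteMeasure
  have hfst : ρ.fst = μ := by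
    refine ext_of_forall_integral_eq_of_IsFiniteMeasure fun f => ?_
    rw [Measure.fst, integral_map measurable_fst.aemeasurable
      f.continuous.measurable.aestronglyMeasurable]
    let k : C(X × X, ℝ) := f.toContinuousMap.comp ContinuousMap.fst
    have h1 := hmarg (f.toContinuousMap - (∫ x, f x ∂μ) • 1) 0 (by
      simp only [ContinuousMap.sub_apply, ContinuousMap.smul_apply, ContinuousMap.one_apply]
      rw [integral_sub (hfi μ f.toContinuousMap) (integrable_const _)]
      simp) (k - (∫ x, f x ∂μ) • 1) (by intro x y; simp [k])
    rw [map_sub, map_smul, hL1, ← hρ] at h1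
    simpa [sub_eq_zero, k] using h1
  have hsnd : ρ.snd = ν := by
    refine ext_of_forall_integral_eq_of_IsFiniteMeasure fun f => ?_
    rw [Measure.snd, integral_map measurable_snd.aemeasurable
      f.continuous.measurable.aestronglyMeasurable]
    let k : C(X × X, ℝ) := f.toContinuousMap.comp ContinuousMap.snd
    have h1 := hmarg 0 (f.toContinuousMap - (∫ x, f x ∂ν) • 1) (by
      simp only [ContinuousMap.sub_apply, ContinuousMap.smul_apply, ContinuousMap.one_apply]
      rw [integral_sub (hfi ν f.toContinuousMap) (integrable_const _)]
      simp) (k - (∫ x, f x ∂ν) • 1) (by intro x y; simp [k])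
    rw [map_sub, map_smul, hL1, ← hρ] at h1
    simpa [sub_eq_zero, k] using h1
  refine ⟨ρ, ⟨?_⟩, hfst, hsnd, ?_⟩
  · rw [← Measure.fst_univ, hfst, measure_univ]
  · let k : C(X × X, ℝ) := ⟨fun p => dist p.1 p.2, continuous_dist⟩
    have h1 := hLs (r • 1 - k) ((mem_s _).2 ⟨0, 0, 1, zero_le_one, by simp, by simp [k]⟩)
    rw [map_sub, map_smul, hL1, ← hρ] at h1
    simpa [k] using h1

/-- If `φ x + ψ y ≤ c + t * d(x, y)` for all `x, y`, some continuous `f` with Lipschitz constant `t`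
separates `φ - c` from `-ψ`. -/
theorem exists_lipschitz_between {X : Type*} [PseudoMetricSpace X] [CompactSpace X] [Nonempty X]
    (φ ψ : C(X, ℝ)) (c t : ℝ) (ht : 0 ≤ t) (h : ∀ x y, φ x + ψ y ≤ c + t * dist x y) :
    ∃ f : C(X, ℝ), (∀ x, φ x - c ≤ f x) ∧ (∀ x, f x ≤ -ψ x) ∧
      ∀ x y, |f x - f y| ≤ t * dist x y := by
  have hbdd (x : X) : BddBelow (Set.range fun y => t * dist x y - ψ y) := by
    refine ⟨φ x - c, ?_⟩
    rintro _ ⟨y, rfl⟩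
    linarith [h x y]
  let f : X → ℝ := fun x => ⨅ y, (t * dist x y - ψ y)
  have hle (x x' : X) : f x ≤ f x' + t * dist x x' := by
    rw [← sub_le_iff_le_add]
    refine le_ciInf fun y => ?_
    have h1 : f x ≤ t * dist x y - ψ y := ciInf_le (hbdd x) y
    have h2 := mul_le_mul_of_nonneg_left (dist_triangle x x' y) ht
    linarith
  have hlip : LipschitzWith ⟨t, ht⟩ f := LipschitzWith.of_le_add_mul _ hle
  refine ⟨⟨f, hlip.continuous⟩, fun x => le_ciInf fun y => by linarith [h x y],
    fun x => (ciInf_le (hbdd x) x).trans (by simp), fun x y => ?_⟩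
  exact hlip.dist_le_mul x y

/-- The Wasserstein distance (inf over probability couplings) coincides with the infimum over
complex measures ρ = g·τ (|g| = 1, so |ρ| = τ) on X × X with marginals μ and ν of
∬ d(x,y) d|ρ|(x,y). -/
theorem stmt1 {X : Type*} [MetricSpace X] [CompactSpace X] [MeasurableSpace X] [BorelSpace X]
    (μ ν : Measure X) [IsProbabilityMeasure μ] [IsProbabilityMeasure ν] :
    sInf {r : ℝ | ∃ ρ : Measure (X × X), IsProbabilityMeasure ρ ∧
        ρ.fst = μ ∧ ρ.snd = ν ∧ r = ∫ p, dist p.1 p.2 ∂ρ}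
      = sInf {r : ℝ | ∃ (τ : Measure (X × X)) (g : X × X → ℂ), IsFiniteMeasure τ ∧
        Measurable g ∧ (∀ p, ‖g p‖ = 1) ∧
        (∀ f : BoundedContinuousFunction X ℝ,
          ∫ p, (f p.1 : ℂ) * g p ∂τ = ∫ x, (f x : ℂ) ∂μ) ∧
        (∀ f : BoundedContinuousFunction X ℝ,
          ∫ p, (f p.2 : ℂ) * g p ∂τ = ∫ x, (f x : ℂ) ∂ν) ∧
        r = ∫ p, dist p.1 p.2 ∂τ} := by
  have hnonneg (ρ : Measure (X × X)) : 0 ≤ ∫ p, dist p.1 p.2 ∂ρ :=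
    integral_nonneg fun p => dist_nonneg
  have : SecondCountableTopology X := UniformSpace.secondCountable_of_separable X
  have : Nonempty X := nonempty_of_isProbabilityMeasure μ
  have hfi (m : Measure X) [IsProbabilityMeasure m] (f : C(X, ℝ)) : Integrable f m :=
    f.continuous.integrable_of_hasCompactSupport (HasCompactSupport.of_compactSpace _)
  apply le_antisymm
  · refine le_csInf ⟨_, μ.prod ν, fun _ => 1, inferInstance, measurable_const, by simp,
      fun f => ?_, fun f => ?_, rfl⟩ ?_
    · simpa using integral_fun_fst (μ := μ) (ν := ν) fun x => (f x : ℂ)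
    · simpa using integral_fun_snd (μ := μ) (ν := ν) fun x => (f x : ℂ)
    · rintro r ⟨τ, g, hτ, hg, hg1, hμ, hν, rfl⟩
      obtain ⟨ρ, hρ, hfst, hsnd, hle⟩ := exists_coupling_integral_dist_le μ ν
        (∫ p, dist p.1 p.2 ∂τ) fun φ ψ c t ht h => by
          obtain ⟨f, hφ, hψ, hf⟩ := exists_lipschitz_between φ ψ c t ht h
          have h1 : ∫ x, φ x ∂μ - c ≤ ∫ x, f x ∂μ := by
            have := integral_mono ((hfi μ φ).sub (integrable_const c)) (hfi μ f) hφ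
            simpa [integral_sub (hfi μ φ) (integrable_const c)] using this
          have h2 : ∫ x, f x ∂ν ≤ -∫ x, ψ x ∂ν := by
            rw [← integral_neg]
            exact integral_mono (hfi ν f) (hfi ν ψ).neg hψ
          have hmul (k : C(X × X, ℝ)) : Integrable (fun p => (k p : ℂ) * g p) τ := by
            refine Integrable.mul_bdd (c := 1) ?_ hg.aestronglyMeasurable
              (Filter.Eventually.of_forall fun p => (hg1 p).le)
            exact (k.continuous.integrable_of_hasCompactSupport
              (HasCompactSupport.of_compactSpace _)).ofReal
          have h3 : ((∫ x, f x ∂μ - ∫ x, f x ∂ν : ℝ) : ℂ) =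
              ∫ p, ((f p.1 : ℂ) * g p - (f p.2 : ℂ) * g p) ∂τ := by
            have e1 := hμ (BoundedContinuousFunction.mkOfCompact f)
            have e2 := hν (BoundedContinuousFunction.mkOfCompact f)
            simp only [BoundedContinuousFunction.mkOfCompact_apply] at e1 e2
            have i1 : Integrable (fun p => (f p.1 : ℂ) * g p) τ := hmul (f.comp ContinuousMap.fst)
            have i2 : Integrable (fun p => (f p.2 : ℂ) * g p) τ := hmul (f.comp ContinuousMap.snd)
            rw [integral_sub i1 i2, e1, e2, integral_complex_ofReal, integral_complex_ofReal,
              Complex.ofReal_sub]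
          have h4 : ∫ x, f x ∂μ - ∫ x, f x ∂ν ≤ t * ∫ p, dist p.1 p.2 ∂τ := by
            refine (le_abs_self _).trans ?_
            rw [← Real.norm_eq_abs, ← Complex.norm_real, h3, ← integral_const_mul]
            refine norm_integral_le_of_norm_le ?_ (Filter.Eventually.of_forall fun p => ?_)
            · exact (continuous_dist.integrable_of_hasCompactSupport
                (HasCompactSupport.of_compactSpace _)).const_mul t
            · rw [← sub_mul, norm_mul, hg1, mul_one, ← Complex.ofReal_sub, Complex.norm_real]
              exact hf p.1 p.2
          linarith
      refine le_trans (csInf_le ⟨0, ?_⟩ ⟨ρ, hρ, hfst, hsnd, rfl⟩) hle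
      rintro _ ⟨ρ', -, -, -, rfl⟩
      exact hnonneg ρ'
  · refine csInf_le_csInf ⟨0, ?_⟩ ⟨_, μ.prod ν, inferInstance, by simp, by simp, rfl⟩ ?_
    · rintro _ ⟨τ, _, -, -, -, -, -, rfl⟩
      exact hnonneg τ
    · rintro _ ⟨ρ, hρ, rfl, rfl, rfl⟩
      refine ⟨ρ, fun _ => 1, inferInstance, measurable_const, by simp, fun f => ?_, fun f => ?_,
        rfl⟩
      · rw [Measure.fst, integral_map measurable_fst.aemeasurable (by fun_prop)]
        simp
      · rw [Measure.snd, integral_map measurable_snd.aemeasurable (by fun_prop)]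
        simp
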